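/- Let R be a commutative noetherian ring, let a ⊆ b be ideals of R, and let X be an arbitrary R-module. Then cd(b, X) ≤ cd(a, X) + ara(b/a). -/

import Mathlib

open CategoryTheory

/-- The cohomological dimension `cd(a, X) = sup {i | H^i_a(X) ≠ 0}` of an `R`-module `X`
with respect to an ideal `a`. -/
noncomputable def cohDim {R : Type} [CommRing R] (a : Ideal R) (X : ModuleCat R) : ℕ :=
  sSup {i : ℕ | Nontrivial ((localCohomology a i).obj X)}

/-- For ideals `a ⊆ b`, the relative arithmetic rank `ara(b/a)`: the least `n` such that there
are `x₁, ..., xₙ ∈ R` with `√((x₁,...,xₙ) + a) = √b`. -/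
noncomputable def araRankRel {R : Type} [CommRing R] (a b : Ideal R) : ℕ :=
  sInf {n : ℕ | ∃ f : Fin n → R, (Ideal.span (Set.range f) + a).radical = b.radical}

open Limits Opposite

universe u

section opHomology
variable {R : Type u} [CommRing R] (K : ChainComplex (ModuleCat.{u} R)ᵒᵖ ℕ)

lemma opHom_surj (n : ℕ) (ξ : (K.homology n).unop) :
    ∃ z : (K.opcycles n).unop, (K.homologyι n).unop z = ξ :=
  (ModuleCat.epi_iff_surjective (K.homologyι n).unop).1 inferInstance ξ

lemma opHom_zero_iff (p : ℕ) (z : (K.opcycles (p+1)).unop) :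
    (K.homologyι (p+1)).unop z = 0 ↔ ∃ g : (K.X p).unop,
      (K.d (p+1) p).unop g = (K.pOpcycles (p+1)).unop z := by
  have h1 : (ShortComplex.mk _ _ (K.homologyι_comp_fromOpcycles (p+1) p)).Exact :=
    ShortComplex.exact_of_f_is_kernel _ (K.homologyIsKernel (p+1) p (by simp))
  have h2 := h1.unop
  rw [ShortComplex.moduleCat_exact_iff] at h2
  have hinj : Function.Injective (K.pOpcycles (p+1)).unop :=
    (ModuleCat.mono_iff_injective _).1 inferInstance
  have hd : ∀ g, (K.d (p+1) p).unop g =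
      (K.pOpcycles (p+1)).unop ((K.fromOpcycles (p+1) p).unop g) := by
    intro g
    rw [← K.p_fromOpcycles (p+1) p]; rfl
  constructor
  · intro h
    obtain ⟨g, hg⟩ := h2 z h
    refine ⟨g, ?_⟩
    exact (hd g).trans (congrArg _ hg)
  · rintro ⟨g, hg⟩
    rw [hd] at hg
    rw [← hinj hg]
    have := congrArg (fun f => f.unop g) (K.homologyι_comp_fromOpcycles (p+1) p)
    exact this

lemma opHom_closed (n : ℕ) (z : (K.opcycles n).unop) :
    (K.d (n+1) n).unop ((K.pOpcycles n).unop z) = 0 := by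
  have := congrArg (fun f => f.unop z) (K.d_pOpcycles (n+1) n)
  exact this

lemma opHom_lift (n : ℕ) (f : (K.X n).unop) (hf : (K.d (n+1) n).unop f = 0) :
    ∃ z : (K.opcycles n).unop, (K.pOpcycles n).unop z = f := by
  have h1 : (ShortComplex.mk _ _ (K.d_pOpcycles (n+1) n)).Exact :=
    ShortComplex.exact_of_g_is_cokernel _ (K.opcyclesIsCokernel (n+1) n (by simp))
  have h2 := h1.unop
  rw [ShortComplex.moduleCat_exact_iff] at h2
  exact h2 f hf
end opHomology

section bridge
variable {R : Type u} [CommRing R]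

/-- The complex `Hom(P, X)`, in the opposite category. -/
noncomputable abbrev yonC {M : ModuleCat.{u} R} (P : ProjectiveResolution M) (X : ModuleCat.{u} R) :
    ChainComplex (ModuleCat.{u} R)ᵒᵖ ℕ :=
  (((linearYoneda R (ModuleCat.{u} R)).obj X).rightOp.mapHomologicalComplex _).obj P.complex

/-- The isomorphism computing `Ext` by a resolution. -/
noncomputable def yonIso {M : ModuleCat.{u} R} (P : ProjectiveResolution M) (X : ModuleCat.{u} R)
    (n : ℕ) : ((yonC P X).homology n).unop ≅ ((Ext R (ModuleCat.{u} R) n).obj (op M)).obj X :=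
  (P.isoLeftDerivedObj ((linearYoneda R _).obj X).rightOp n).unop

/-- `f` is a cocycle in a projective resolution representing the `Ext` class `ξ`. -/
def ExtRep {M : ModuleCat.{u} R} (P : ProjectiveResolution M) (X : ModuleCat.{u} R) (n : ℕ)
    (ξ : ((Ext R (ModuleCat.{u} R) n).obj (op M)).obj X) (f : P.complex.X n ⟶ X) : Prop :=
  ∃ z : ((yonC P X).opcycles n).unop,
    (yonIso P X n).hom (((yonC P X).homologyι n).unop z) = ξ ∧
    ((yonC P X).pOpcycles n).unop z = f

variable {M : ModuleCat.{u} R} (P : ProjectiveResolution M) (X : ModuleCat.{u} R)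

lemma ExtRep.exists (n : ℕ) (ξ : ((Ext R (ModuleCat.{u} R) n).obj (op M)).obj X) :
    ∃ f, ExtRep P X n ξ f := by
  have hs : Function.Surjective
      (yonIso P X n).hom :=
    (ModuleCat.epi_iff_surjective _).1 inferInstance
  obtain ⟨y, hy⟩ := hs ξ
  obtain ⟨z, hz⟩ := opHom_surj (yonC P X) n y
  exact ⟨((yonC P X).pOpcycles n).unop z, z, by rw [hz]; exact hy, rfl⟩

lemma ExtRep.closed {n : ℕ} {ξ} {f : P.complex.X n ⟶ X} (h : ExtRep P X n ξ f) :
    P.complex.d (n+1) n ≫ f = 0 := by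
  obtain ⟨z, -, rfl⟩ := h
  exact opHom_closed (yonC P X) n z

lemma ExtRep.of_closed {n : ℕ} (f : P.complex.X n ⟶ X) (h : P.complex.d (n+1) n ≫ f = 0) :
    ∃ ξ, ExtRep P X n ξ f := by
  obtain ⟨z, hz⟩ := opHom_lift (yonC P X) n f h
  exact ⟨_, z, rfl, hz⟩

lemma ExtRep.eq_zero_iff {p : ℕ} {ξ} {f : P.complex.X (p+1) ⟶ X} (h : ExtRep P X (p+1) ξ f) :
    ξ = 0 ↔ ∃ g : P.complex.X p ⟶ X, P.complex.d (p+1) p ≫ g = f := by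
  obtain ⟨z, rfl, rfl⟩ := h
  have hs : Function.Injective
      (yonIso P X (p+1)).hom :=
    (ModuleCat.mono_iff_injective _).1 inferInstance
  have := opHom_zero_iff (yonC P X) p z
  rw [← map_zero (ModuleCat.Hom.hom (yonIso P X (p+1)).hom)]
  exact hs.eq_iff.trans this

lemma ExtRep.map {N : ModuleCat.{u} R} (Q : ProjectiveResolution N) (g : N ⟶ M)
    (φ : ProjectiveResolution.Hom Q P g) {n : ℕ} {ξ} {f : P.complex.X n ⟶ X}
    (h : ExtRep P X n ξ f) :
    ExtRep Q X n (((Ext R (ModuleCat.{u} R) n).map g.op).app X ξ) (φ.hom.f n ≫ f) := by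
  obtain ⟨z, rfl, rfl⟩ := h
  have hc := ProjectiveResolution.isoLeftDerivedObj_hom_naturality g Q P φ.hom
    (by simpa using φ.hom_f_zero_comp_π_f_zero) ((linearYoneda R (ModuleCat.{u} R)).obj X).rightOp n
  let F : yonC Q X ⟶ yonC P X := (((linearYoneda R (ModuleCat.{u} R)).obj X).rightOp.mapHomologicalComplex
    (ComplexShape.down ℕ)).map φ.hom
  refine ⟨(HomologicalComplex.opcyclesMap F n).unop z, ?_, ?_⟩
  · have h1 := congrArg (fun f => f.unop z) (HomologicalComplex.homologyι_naturality F n)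
    have h2 := congrArg (fun f => f.unop (((yonC P X).homologyι n).unop z)) hc
    refine Eq.trans ?_ h2.symm
    exact congrArg _ h1.symm
  · exact congrArg (fun f => f.unop z) (HomologicalComplex.p_opcyclesMap F n)

/-- Comparison of the two `Ext`s as far as vanishing is concerned. -/
lemma ext_bridge {p : ℕ} {f : P.complex.X (p+1) ⟶ X} {ξ} (h : ExtRep P X (p+1) ξ f)
    {N : ModuleCat.{u} R} (g : N ⟶ M) :
    ((Ext R (ModuleCat.{u} R) (p+1)).map g.op).app X ξ = 0 ↔
      (Abelian.Ext.mk₀ g).comp (P.extMk f (p+2) rfl h.closed) (zero_add _) = 0 := by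
  let Q := projectiveResolution N
  let φ : ProjectiveResolution.Hom Q P g := ⟨ProjectiveResolution.lift g Q P,
    (ProjectiveResolution.lift_commutes_zero g Q P).trans (by simp)⟩
  rw [ProjectiveResolution.mk₀_comp_extMk _ _ _ _ φ,
    ProjectiveResolution.extMk_eq_zero_iff _ _ _ _ _ p rfl, (h.map P X Q g φ).eq_zero_iff]

end bridge

section colim
variable {R : Type} [CommRing R]

/-- The projection `R/I → R/J`. -/
noncomputable def qmap {I J : Ideal R} (h : I ≤ J) : ModuleCat.of R (R ⧸ I) ⟶ ModuleCat.of R (R ⧸ J) :=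
  ModuleCat.ofHom (Submodule.mapQ I J LinearMap.id h)

lemma qmap_comp {I J K : Ideal R} (h : I ≤ J) (h' : J ≤ K) :
    qmap h ≫ qmap h' = qmap (h.trans h') := by
  ext
  rfl

lemma locCoh_subsingleton_iff (a : Ideal R) (i : ℕ) (X : ModuleCat R) :
    Subsingleton ((localCohomology a i).obj X) ↔
    ∀ (t : ℕ) (ξ : ((Ext R (ModuleCat R) i).obj (op (ModuleCat.of R (R ⧸ a ^ t)))).obj X),
      ∃ (s : ℕ) (h : t ≤ s),
        ((Ext R (ModuleCat R) i).map (qmap (Ideal.pow_le_pow_right h)).op).app X ξ = 0 := by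
  let D := localCohomology.diagram (localCohomology.idealPowersDiagram a) i
  let c : Cocone D := colimit.cocone D
  let hc : IsColimit c := colimit.isColimit D
  let hc' := isColimitOfPreserves ((evaluation _ _).obj X) hc
  let hc'' := isColimitOfPreserves (forget (ModuleCat R)) hc'
  have hpt : (((evaluation _ _).obj X).mapCocone c).pt = (localCohomology a i).obj X := rfl
  rw [← hpt]
  constructor
  · intro hs t ξ
    obtain ⟨k, f, g, hk⟩ := (Concrete.isColimit_rep_eq_iff_exists (D ⋙ (evaluation _ _).obj X) hc' 
      (i := op (op t)) (j := op (op t)) ξ 0).1 (hs.elim _ _)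
    refine ⟨k.unop.unop, leOfHom f.unop.unop, ?_⟩
    refine Eq.trans hk (map_zero (ModuleCat.Hom.hom _))
  · intro h
    refine ⟨fun x y => ?_⟩
    have : ∀ x : (((evaluation _ _).obj X).mapCocone c).pt, x = 0 := by
      intro x
      obtain ⟨j, y, rfl⟩ := Concrete.isColimit_exists_rep (D ⋙ (evaluation _ _).obj X) hc' x
      obtain ⟨s, hs, h0⟩ := h j.unop.unop y
      let f : j ⟶ op (op s) := (homOfLE hs).op.op
      have := (((evaluation _ _).obj X).mapCocone c).w f
      rw [← this]
      refine (congrArg (((((evaluation _ _).obj X).mapCocone c).ι.app (op (op s)))) h0).trans ?_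
      exact map_zero (ModuleCat.Hom.hom _)
    rw [this x, this y]

lemma locCoh_iff (a : Ideal R) (p : ℕ) (X : ModuleCat R) :
    Subsingleton ((localCohomology a (p+1)).obj X) ↔
    ∀ (t : ℕ) (ξ : Abelian.Ext (ModuleCat.of R (R ⧸ a ^ t)) X (p+1)),
      ∃ (s : ℕ) (h : t ≤ s),
        (Abelian.Ext.mk₀ (qmap (Ideal.pow_le_pow_right (I := a) h))).comp ξ (zero_add _) = 0 := by
  rw [locCoh_subsingleton_iff]
  constructor
  · intro H t ξ
    obtain ⟨f, hf, rfl⟩ := (projectiveResolution (ModuleCat.of R (R ⧸ a ^ t))).extMk_surjective ξ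
      (p+2) rfl
    obtain ⟨η, hη⟩ := ExtRep.of_closed _ X f hf
    obtain ⟨s, h, h0⟩ := H t η
    exact ⟨s, h, (ext_bridge _ X hη _).1 h0⟩
  · intro H t η
    obtain ⟨f, hη⟩ := ExtRep.exists (projectiveResolution (ModuleCat.of R (R ⧸ a ^ t))) X _ η
    obtain ⟨s, h, h0⟩ := H t (ProjectiveResolution.extMk _ f (p+2) rfl hη.closed)
    exact ⟨s, h, (ext_bridge _ X hη _).2 h0⟩

end colim

section key
variable {R : Type} [CommRing R]
open Abelian

/-- Multiplication by `c` as a map `R/I → R/J`. -/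
noncomputable def mulq (c : R) {I J : Ideal R} (h : ∀ y ∈ I, c * y ∈ J) :
    ModuleCat.of R (R ⧸ I) ⟶ ModuleCat.of R (R ⧸ J) :=
  ModuleCat.ofHom (Submodule.mapQ I J (LinearMap.mulLeft R c) h)

lemma quot_hom_ext {I : Ideal R} {M : ModuleCat R} {f g : ModuleCat.of R (R ⧸ I) ⟶ M}
    (h : ∀ y : R, f.hom (Submodule.Quotient.mk y) = g.hom (Submodule.Quotient.mk y)) : f = g := by
  apply ModuleCat.hom_ext
  apply LinearMap.ext
  intro x
  obtain ⟨x, rfl⟩ := Submodule.Quotient.mk_surjective _ x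
  exact h x

/-- The colon ideal `(J : r)`. -/
def colonI (J : Ideal R) (r : R) : Ideal R := Submodule.comap (LinearMap.mulLeft R r) J

lemma mem_colonI {J : Ideal R} {r y : R} : y ∈ colonI J r ↔ r * y ∈ J := Iff.rfl

/-- `0 → R/(J : r) → R/J → R/(J + (r)) → 0`. -/
noncomputable abbrev colonSC (J : Ideal R) (r : R) : ShortComplex (ModuleCat R) :=
  ShortComplex.mk (mulq r (I := colonI J r) (J := J) (fun _ hy => hy))
    (qmap (le_sup_left : J ≤ J ⊔ Ideal.span {r})) (by
      ext
      refine (Submodule.Quotient.mk_eq_zero _).2 ?_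
      exact Ideal.mem_sup_right (Ideal.mul_mem_right _ _ (Ideal.mem_span_singleton_self r)))

lemma colonSC_shortExact (J : Ideal R) (r : R) : (colonSC J r).ShortExact := by
  have h1 : Mono (colonSC J r).f := by
    rw [ModuleCat.mono_iff_injective]
    refine (injective_iff_map_eq_zero (mulq r (I := colonI J r) (J := J) (fun _ hy => hy)).hom).2 ?_
    intro x hx
    obtain ⟨x, rfl⟩ := Submodule.Quotient.mk_surjective _ x
    exact (Submodule.Quotient.mk_eq_zero _).2 ((Submodule.Quotient.mk_eq_zero J).1 hx)
  have h2 : Epi (colonSC J r).g := by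
    rw [ModuleCat.epi_iff_surjective]
    intro x
    obtain ⟨x, rfl⟩ := Submodule.Quotient.mk_surjective _ x
    exact ⟨Submodule.Quotient.mk x, rfl⟩
  refine ShortComplex.ShortExact.mk ?_
  rw [ShortComplex.moduleCat_exact_iff]
  intro x hx
  obtain ⟨x, rfl⟩ := Submodule.Quotient.mk_surjective _ x
  have hx' := (Submodule.Quotient.mk_eq_zero _).1 hx
  obtain ⟨y, hy, z, hz, hyz⟩ := Submodule.mem_sup.1 hx'
  obtain ⟨w, rfl⟩ := Ideal.mem_span_singleton.1 hz
  refine ⟨Submodule.Quotient.mk w, ?_⟩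
  refine (Submodule.Quotient.eq _).2 ?_
  have : r * w - x = - y := by
    rw [← show y + r * w = x from hyz]; ring
  exact this ▸ J.neg_mem hy

/-- Morphism between the above sequences. -/
noncomputable def colonMap {J' J : Ideal R} (h : J' ≤ J) (r c : R) :
    colonSC J' (r * c) ⟶ colonSC J r where
  τ₁ := mulq c (I := colonI J' (r * c)) (J := colonI J r) (fun y hy => by
    rw [mem_colonI] at hy ⊢
    rw [← mul_assoc]; exact h hy)
  τ₂ := qmap h
  τ₃ := qmap (sup_le_sup h (by
    rw [Ideal.span_singleton_le_span_singleton]; exact Dvd.intro _ rfl))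
  comm₁₂ := by
    refine quot_hom_ext fun y => ?_
    change Submodule.Quotient.mk (r * (c * y)) = Submodule.Quotient.mk (r * c * y)
    rw [mul_assoc]
  comm₂₃ := quot_hom_ext fun y => rfl

lemma mk0_comp_mk0 {A B C X : ModuleCat R} {n : ℕ} (f : A ⟶ B) (g : B ⟶ C) (ξ : Ext C X n) :
    (Ext.mk₀ f).comp ((Ext.mk₀ g).comp ξ (zero_add _)) (zero_add _) =
      (Ext.mk₀ (f ≫ g)).comp ξ (zero_add _) := by
  simp

/-- Uniform formulation of vanishing of `H^i_a(X)`. -/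
def Van (a : Ideal R) (X : ModuleCat R) (i : ℕ) : Prop :=
  ∀ (t : ℕ) (ξ : Abelian.Ext (ModuleCat.of R (R ⧸ a ^ t)) X i),
      ∃ (s : ℕ) (h : t ≤ s),
        (Abelian.Ext.mk₀ (qmap (Ideal.pow_le_pow_right (I := a) h))).comp ξ (zero_add _) = 0

lemma colon_stab [IsNoetherianRing R] (J : Ideal R) (x : R) (t : ℕ) :
    ∃ N : ℕ, ∀ y, x ^ t * x ^ N * y ∈ J → x ^ N * y ∈ J := by
  let f : ℕ →o Ideal R := ⟨fun n => colonI J (x ^ n), fun m n hmn y hy => by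
    change x ^ n * y ∈ J
    rw [← Nat.sub_add_cancel hmn, pow_add, mul_assoc]
    exact J.mul_mem_left _ hy⟩
  obtain ⟨N, hN⟩ := monotone_stabilizes_iff_noetherian.2 ‹_› f
  refine ⟨N, fun y hy => ?_⟩
  have h1 : y ∈ f (N + t) := by
    change x ^ (N + t) * y ∈ J
    rwa [pow_add, mul_comm (x ^ N)]
  rw [← hN (N + t) (by omega)] at h1
  exact h1

lemma Van.step [IsNoetherianRing R] (a : Ideal R) (x : R) (X : ModuleCat R) (q : ℕ)
    (h0 : Van a X q) (h1 : Van a X (q + 1)) : Van (a ⊔ Ideal.span {x}) X (q + 1) := by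
  intro T ξ₀
  have hT : a ^ T ⊔ Ideal.span {x ^ T} ≤ (a ⊔ Ideal.span {x}) ^ T := by
    refine sup_le (Ideal.pow_right_mono le_sup_left _) ?_
    rw [← Ideal.span_singleton_pow]
    exact Ideal.pow_right_mono le_sup_right _
  set ξ := (Ext.mk₀ (qmap hT)).comp ξ₀ (zero_add _) with hξ
  obtain ⟨s, hs, hs0⟩ := h1 T ((Ext.mk₀ (qmap le_sup_left)).comp ξ (zero_add _))
  have hst : a ^ s ≤ a ^ T := Ideal.pow_le_pow_right hs
  have hE1 := colonSC_shortExact (a ^ s) (x ^ T)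
  set ξ₁ := (Ext.mk₀ (qmap (sup_le_sup_right hst (Ideal.span {x ^ T})))).comp ξ (zero_add _) with hξ₁
  obtain ⟨η, hη⟩ := Ext.contravariant_sequence_exact₃ hE1 X ξ₁ (by
    rw [hξ₁]
    refine (mk0_comp_mk0 _ _ ξ).trans (Eq.trans ?_ ((mk0_comp_mk0 _ _ ξ).symm.trans hs0))
    rw [qmap_comp, qmap_comp]) (n₀ := q) (by omega)
  have hc : a ^ s ≤ colonI (a ^ s) (x ^ T) := fun y hy => Ideal.mul_mem_left _ _ hy
  obtain ⟨s', hs', hs'0⟩ := h0 s ((Ext.mk₀ (qmap hc)).comp η (zero_add _))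
  have hst' : a ^ s' ≤ a ^ s := Ideal.pow_le_pow_right hs'
  obtain ⟨N, hN⟩ := colon_stab (a ^ s') x T
  have hE2 := colonSC_shortExact (a ^ s') (x ^ T * x ^ N)
  let φ := colonMap hst' (x ^ T) (x ^ N)
  have hτ : φ.τ₁ = mulq (x ^ N) (I := colonI (a ^ s') (x ^ T * x ^ N)) (J := a ^ s') hN ≫
      qmap hst' ≫ qmap hc := quot_hom_ext fun y => rfl
  have hφ : (Ext.mk₀ φ.τ₁).comp η (zero_add _) = 0 := by
    rw [hτ]
    refine (mk0_comp_mk0 _ _ η).symm.trans ?_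
    refine (congrArg (fun e => (Ext.mk₀ _).comp e (zero_add _))
      ((mk0_comp_mk0 _ _ η).symm.trans hs'0)).trans ?_
    exact Ext.comp_zero _ _ _ _ _
  have hnat := ShortComplex.ShortExact.extClass_naturality hE2 hE1 φ
  have key : (Ext.mk₀ φ.τ₃).comp ξ₁ (zero_add _) = 0 := by
    rw [← hη, ← Ext.comp_assoc _ _ _ (zero_add 1) (by omega) (by omega), ← hnat,
      Ext.comp_assoc _ _ _ (add_zero 1) (zero_add q) (by omega), hφ, Ext.comp_zero]
  have hM : (a ⊔ Ideal.span {x}) ^ (s' + (T + N)) ≤ a ^ s' ⊔ Ideal.span {x ^ T * x ^ N} := by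
    refine (Ideal.sup_pow_add_le_pow_sup_pow).trans ?_
    rw [Ideal.span_singleton_pow, pow_add]
  refine ⟨s' + (T + N), by omega, ?_⟩
  have h3 : (Ext.mk₀ (qmap hM)).comp ((Ext.mk₀ φ.τ₃).comp ξ₁ (zero_add _)) (zero_add _) = 0 := by
    rw [key]; exact Ext.comp_zero _ _ _ _ _
  rw [hξ₁, hξ, mk0_comp_mk0, mk0_comp_mk0, mk0_comp_mk0] at h3
  rw [show qmap (Ideal.pow_le_pow_right (I := a ⊔ Ideal.span {x}) (show T ≤ s' + (T + N) by omega)) =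
    ((qmap hM ≫ φ.τ₃) ≫ qmap (sup_le_sup_right hst (Ideal.span {x ^ T}))) ≫ qmap hT from
      quot_hom_ext fun y => rfl]
  exact h3

lemma van_bot (X : ModuleCat R) (q : ℕ) : Van (⊥ : Ideal R) X (q + 1) := by
  intro t ξ
  refine ⟨t + 1, by omega, ?_⟩
  have : Projective (ModuleCat.of R (R ⧸ (⊥ : Ideal R) ^ (t + 1))) := by
    have e : (R ⧸ (⊥ : Ideal R) ^ (t + 1)) ≃ₗ[R] R :=
      (Submodule.quotEquivOfEqBot _ (by
        rw [pow_succ]; exact Ideal.mul_bot _))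
    have : Module.Projective R (R ⧸ (⊥ : Ideal R) ^ (t + 1)) := Module.Projective.of_equiv e.symm
    infer_instance
  exact Ext.eq_zero_of_projective _

lemma van_add [IsNoetherianRing R] (X : ModuleCat R) (n : ℕ) (f : Fin n → R) (a : Ideal R) (d : ℕ)
    (h : ∀ i, d < i → Van a X i) :
    ∀ i, d + n < i → Van (Ideal.span (Set.range f) + a) X i := by
  induction n with
  | zero => simpa using h
  | succ n ih =>
    intro i hi
    obtain ⟨q, rfl⟩ : ∃ q, i = q + 1 := ⟨i - 1, by omega⟩
    have := ih (fun j => f j.succ)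
    have h2 : Ideal.span (Set.range f) + a =
        (Ideal.span (Set.range fun j : Fin n => f j.succ) + a) ⊔ Ideal.span {f 0} := by
      conv_lhs => rw [← Fin.cons_self_tail f, Fin.range_cons, Ideal.span_insert]
      simp only [Submodule.add_eq_sup, Fin.tail_def]
      rw [sup_assoc, sup_comm]
    rw [h2]
    exact Van.step _ _ _ _ (this q (by omega)) (this (q+1) (by omega))
end key

lemma not_nontrivial_iff_van {R : Type} [CommRing R] (a : Ideal R) (X : ModuleCat R) {i : ℕ}
    (hi : 0 < i) : ¬ Nontrivial ((localCohomology a i).obj X) ↔ Van a X i := by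
  obtain ⟨q, rfl⟩ : ∃ q, i = q + 1 := ⟨i - 1, by omega⟩
  rw [not_nontrivial_iff_subsingleton, locCoh_iff]
  rfl

/-- Let `R` be a commutative noetherian ring, `a ⊆ b` ideals of `R` and `X` an
arbitrary `R`-module.  Then `cd(b, X) ≤ cd(a, X) + ara(b/a)`. -/
theorem statement5 {R : Type} [CommRing R] [IsNoetherianRing R] (a b : Ideal R) (hab : a ≤ b)
    (X : ModuleCat R) :
    cohDim b X ≤ cohDim a X + araRankRel a b := by
  -- vanishing above `cohDim`, using finiteness
  have hvan : ∀ i, cohDim a X < i → Van a X i := by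
    intro i hi
    rw [← not_nontrivial_iff_van a X (by omega)]
    intro hn
    obtain ⟨n, f, hf⟩ := Submodule.fg_iff_exists_fin_generating_family.1 (IsNoetherian.noetherian a)
    have hb : BddAbove {i : ℕ | Nontrivial ((localCohomology a i).obj X)} := by
      refine ⟨n, fun j hj => ?_⟩
      by_contra hlt
      have h1 := van_add X n f ⊥ 0 (fun i hi => by
        obtain ⟨q, rfl⟩ : ∃ q, i = q + 1 := ⟨i - 1, by omega⟩
        exact van_bot X q) j (by omega)
      rw [show Ideal.span (Set.range f) + ⊥ = a by
        rw [← hf]; exact sup_bot_eq _] at h1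
      exact (not_nontrivial_iff_van a X (by omega)).2 h1 hj
    exact absurd (le_csSup hb hn) (not_le.2 hi)
  have hne : {n : ℕ | ∃ f : Fin n → R,
      (Ideal.span (Set.range f) + a).radical = b.radical}.Nonempty := by
    obtain ⟨n, f, hf⟩ := Submodule.fg_iff_exists_fin_generating_family.1 (IsNoetherian.noetherian b)
    refine ⟨n, f, ?_⟩
    rw [show Ideal.span (Set.range f) + a = b by
      rw [show Ideal.span (Set.range f) = b from hf]; exact sup_eq_left.2 hab]
  obtain ⟨f, hf⟩ := Nat.sInf_mem hne
  refine csSup_le' ?_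
  intro i hi
  by_contra hlt
  have h1 := van_add X _ f a _ hvan i (not_le.1 hlt)
  rw [← not_nontrivial_iff_van _ X (by omega), not_nontrivial_iff_subsingleton] at h1
  have e := ((localCohomology.isoOfSameRadical hf i).app X).toLinearEquiv
  exact not_nontrivial_iff_subsingleton.2 (e.symm.toEquiv.subsingleton) hi
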